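/- arXiv:1603.07863 — 8 statements merged into one kernel-verified Lean document; each statement's English description precedes it below -/
import Mathlib

section
/- Let a and b be positive integers. Then there exists a prime p such that S(n) = F_{an+b} does not have the Lucas property with the prime p, and there exists a prime q such that S(n) = L_{an+b} does not have the Lucas property with the prime q; that is, neither F_{an+b} nor L_{an+b} is an LP function. -/
/-- `S` has the Lucas property with the prime `p`: for every `r ≥ 0` and all digits
`n_0, …, n_r` with `0 ≤ n_i ≤ p - 1`, one has
`S (∑ n_i p^i) ≡ ∏ S (n_i) (mod p)`. -/
def HasLucasProperty (p : ℕ) (S : ℕ → ℤ) : Prop :=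
  ∀ (r : ℕ) (d : ℕ → ℕ), (∀ i, i ≤ r → d i ≤ p - 1) →
    S (∑ i ∈ Finset.range (r + 1), d i * p ^ i) ≡
      ∏ i ∈ Finset.range (r + 1), S (d i) [ZMOD (p : ℤ)]

/-- The Lucas numbers: `L 0 = 2`, `L 1 = 1`, `L (n+2) = L (n+1) + L n`. -/
def lucasNum : ℕ → ℤ
  | 0 => 2
  | 1 => 1
  | n + 2 => lucasNum (n + 1) + lucasNum n

theorem aux_five : ¬ IsSquare (((2 : ℤ) : ZMod 5)) := by decide

theorem aux_field (p : ℕ) [hp : Fact p.Prime] (h5 : p % 5 = 2) (hp5 : 5 < p) :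
    ∃ α β : AlgebraicClosure (ZMod p), α + β = 1 ∧ α * β = -1 ∧ α ^ p = β ∧ β ^ p = α ∧
      α - β ≠ 0 := by
  have hodd : p ≠ 2 := by omega
  have hcop : ∀ m : ℕ, 0 < m → m < p → ((m : ℕ) : AlgebraicClosure (ZMod p)) ≠ 0 := by
    intro m h0 hm h
    rw [CharP.cast_eq_zero_iff (AlgebraicClosure (ZMod p)) p] at h
    exact absurd (Nat.le_of_dvd h0 h) (by omega)
  have h2 : (2 : AlgebraicClosure (ZMod p)) ≠ 0 := by
    exact_mod_cast hcop 2 (by omega) (by omega)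
  have h50 : (5 : AlgebraicClosure (ZMod p)) ≠ 0 := by
    exact_mod_cast hcop 5 (by omega) (by omega)
  have hleg : legendreSym p 5 = -1 := by
    have : Fact (Nat.Prime 5) := ⟨by norm_num⟩
    have h := legendreSym.quadratic_reciprocity_one_mod_four (p := 5) (q := p) (by norm_num) hodd
    have e : legendreSym 5 p = legendreSym 5 2 := by
      rw [legendreSym.mod 5 (p : ℤ)]
      congr 1
      omega
    have e2 : legendreSym 5 2 = -1 := by
      rw [legendreSym.eq_neg_one_iff]
      exact aux_five
    rw [e, e2] at h
    exact_mod_cast h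
  have hpow : (5 : ZMod p) ^ (p / 2) = -1 := by
    have h := legendreSym.eq_pow p 5
    rw [hleg] at h
    push_cast at h
    exact h.symm
  have hpow' : (5 : AlgebraicClosure (ZMod p)) ^ (p / 2) = -1 := by
    have := congrArg (algebraMap (ZMod p) (AlgebraicClosure (ZMod p))) hpow
    rw [map_pow, map_ofNat, map_neg, map_one] at this
    exact this
  obtain ⟨s, hs⟩ := IsAlgClosed.exists_pow_nat_eq (5 : AlgebraicClosure (ZMod p)) (n := 2) (by norm_num)
  have hsp : s ^ p = -s := by
    have hpo : p = 2 * (p / 2) + 1 := by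
      have := hp.out.eq_two_or_odd
      omega
    calc s ^ p = s ^ (2 * (p / 2) + 1) := by rw [← hpo]
      _ = (s ^ 2) ^ (p / 2) * s := by rw [pow_succ, pow_mul]
      _ = -s := by rw [hs, hpow']; ring
  have hs0 : s ≠ 0 := by
    rintro rfl
    apply h50
    rw [← hs]; ring
  have h2p : (2 : AlgebraicClosure (ZMod p)) ^ p = 2 := by
    have := congrArg (algebraMap (ZMod p) (AlgebraicClosure (ZMod p))) (ZMod.pow_card (2 : ZMod p))
    rw [map_pow, map_ofNat] at this
    exact this
  refine ⟨(1 + s) / 2, (1 - s) / 2, ?_, ?_, ?_, ?_, ?_⟩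
  · field_simp; ring
  · field_simp; linear_combination -hs
  · rw [div_pow, h2p, add_pow_char, hsp, one_pow]; ring
  · rw [div_pow, h2p, sub_pow_char, hsp, one_pow]; ring
  · have : (1 + s) / 2 - (1 - s) / 2 = s := by field_simp; ring
    rw [this]; exact hs0

theorem aux_fib {K : Type*} [Field K] (α β : K) (h1 : α + β = 1) (h2 : α * β = -1) (n : ℕ) :
    (α - β) * (Nat.fib n : K) = α ^ n - β ^ n := by
  induction n using Nat.twoStepInduction with
  | zero => simp
  | one => simp
  | more n ih1 ih2 =>
    rw [Nat.fib_add_two]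
    push_cast
    have hb : β = 1 - α := by linear_combination h1
    subst hb
    rw [mul_add, ih1, ih2]
    linear_combination (α ^ n - (1 - α) ^ n) * h2

theorem aux_luc {K : Type*} [Field K] (α β : K) (h1 : α + β = 1) (h2 : α * β = -1) (n : ℕ) :
    (lucasNum n : K) = α ^ n + β ^ n := by
  induction n using Nat.twoStepInduction with
  | zero => simp [lucasNum]; norm_num
  | one => simp [lucasNum, h1]
  | more n ih1 ih2 =>
    rw [lucasNum]
    push_cast
    have hb : β = 1 - α := by linear_combination h1
    subst hb
    rw [ih1, ih2]
    linear_combination (α ^ n + (1 - α) ^ n) * h2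

theorem luc_pos (n : ℕ) : 0 < lucasNum n := by
  induction n using Nat.twoStepInduction with
  | zero => simp [lucasNum]
  | one => simp [lucasNum]
  | more n ih1 ih2 => rw [lucasNum]; omega

theorem aux_prime (N : ℕ) : ∃ p, p.Prime ∧ p % 5 = 2 ∧ N < p := by
  have h : IsUnit (2 : ZMod 5) := by decide
  obtain ⟨p, h1, h2, h3⟩ := Nat.forall_exists_prime_gt_and_eq_mod h N
  refine ⟨p, h2, ?_, h1⟩
  have : ((p : ℕ) : ZMod 5) = ((2 : ℕ) : ZMod 5) := by exact_mod_cast h3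
  exact (ZMod.natCast_eq_natCast_iff' _ _ _).1 this

theorem aux_small_zero (x : ℤ) (h : ∀ N : ℕ, ∃ p : ℕ, N < p ∧ (p : ℤ) ∣ x) : x = 0 := by
  obtain ⟨p, h1, h2⟩ := h x.natAbs
  exact Int.eq_zero_of_abs_lt_dvd h2 (by rw [Int.abs_eq_natAbs]; omega)

theorem S_zero (S : ℕ → ℤ) (h : ∀ p : ℕ, p.Prime → HasLucasProperty p S) (h0 : 0 < S 0) :
    S 0 = 1 := by
  have h1 : S 0 * S 0 - S 0 = 0 := by
    apply aux_small_zero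
    intro N
    obtain ⟨p, hp, h5, hN⟩ := aux_prime N
    refine ⟨p, hN, ?_⟩
    have := h p hp 1 (fun _ => 0) (by simp)
    simp at this
    rw [← pow_two]
    exact this.dvd
  nlinarith

theorem S_key (S : ℕ → ℤ) (h : ∀ p : ℕ, p.Prime → HasLucasProperty p S) (h0 : S 0 = 1)
    (p : ℕ) (hp : p.Prime) : S p ≡ S 1 [ZMOD p] := by
  have := h p hp 1 (fun i => i) (by
    intro i hi
    have := hp.two_le
    omega)
  simpa [Finset.sum_range_succ, Finset.prod_range_succ, h0] using this

theorem key_zero (S : ℕ → ℤ) (h : ∀ p : ℕ, p.Prime → HasLucasProperty p S) (h0 : S 0 = 1) (x : ℤ)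
    (hx : ∀ p : ℕ, ∀ _ : Fact p.Prime, ∀ α β : AlgebraicClosure (ZMod p),
      α + β = 1 → α * β = -1 → α ^ p = β → β ^ p = α → α - β ≠ 0 →
      (S p : AlgebraicClosure (ZMod p)) = S 1 → (x : AlgebraicClosure (ZMod p)) = 0) : x = 0 := by
  apply aux_small_zero
  intro N
  obtain ⟨p, hp, h5, hN⟩ := aux_prime (N + 5)
  have : Fact p.Prime := ⟨hp⟩
  refine ⟨p, by omega, ?_⟩
  obtain ⟨α, β, a1, a2, a3, a4, a5⟩ := aux_field p h5 (by omega)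
  rw [← CharP.intCast_eq_zero_iff (AlgebraicClosure (ZMod p)) p]
  refine hx p this α β a1 a2 a3 a4 a5 ?_
  exact (CharP.intCast_eq_intCast (AlgebraicClosure (ZMod p)) p).2 (S_key S h h0 p hp)

theorem fib_lucas_not_LP (a b : ℕ) (ha : 0 < a) (hb : 0 < b) :
    (∃ p : ℕ, p.Prime ∧ ¬ HasLucasProperty p (fun n => (Nat.fib (a * n + b) : ℤ))) ∧
    (∃ q : ℕ, q.Prime ∧ ¬ HasLucasProperty q (fun n => lucasNum (a * n + b))) := by
  constructor
  · by_contra! h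
    have h0 := S_zero _ h (by simpa using hb)
    have hb2 : b = 1 ∨ b = 2 := by
      by_contra hc
      have h3 : Nat.fib 3 ≤ Nat.fib b := Nat.fib_mono (by omega)
      have h4 : Nat.fib 3 = 2 := by decide
      simp at h0
      omega
    rcases hb2 with rfl | rfl
    · obtain ⟨c, rfl⟩ : ∃ c, a = c + 1 := ⟨a - 1, by omega⟩
      have := key_zero _ h h0 (Nat.fib (c + 1) : ℤ) (by
        intro p _ α β a1 a2 a3 a4 a5 hS
        apply (mul_eq_zero.1 _).resolve_left a5
        have e1 := aux_fib α β a1 a2 ((c + 1) * p + 1)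
        have e2 := aux_fib α β a1 a2 (c + 1 + 1)
        have e3 := aux_fib α β a1 a2 c
        rw [pow_succ, pow_succ, mul_comm (c + 1) p, pow_mul, pow_mul, a3, a4] at e1
        rw [Nat.fib_add_two] at e2
        simp only [mul_one, Int.cast_natCast] at hS ⊢
        rw [Nat.fib_add_two, mul_comm (c + 1) p] at hS
        push_cast at hS e2 ⊢
        rw [hS] at e1
        linear_combination e1 - e3 + (β ^ c - α ^ c) * a2)
      have h1 := Nat.fib_pos.2 (Nat.succ_pos c)
      simp at this
    · by_cases hc : a = 1
      · subst hc
        have := key_zero _ h h0 3 (by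
          intro p _ α β a1 a2 a3 a4 a5 hS
          apply (mul_eq_zero.1 _).resolve_left a5
          have e1 := aux_fib α β a1 a2 (p + 2)
          rw [pow_add, pow_add, a3, a4] at e1
          simp only [one_mul, Int.cast_natCast] at hS
          rw [hS] at e1
          have : Nat.fib (1 + 2) = 2 := by decide
          rw [this] at e1
          push_cast at e1 ⊢
          linear_combination e1 + (α - β) * a2)
        omega
      · obtain ⟨c, rfl⟩ : ∃ c, a = c + 2 := ⟨a - 2, by omega⟩
        have := key_zero _ h h0 (Nat.fib (c + 2 + 2) + Nat.fib c : ℤ) (by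
          intro p _ α β a1 a2 a3 a4 a5 hS
          apply (mul_eq_zero.1 _).resolve_left a5
          have e1 := aux_fib α β a1 a2 ((c + 2) * p + 2)
          have e3 := aux_fib α β a1 a2 c
          rw [pow_add, pow_add, mul_comm (c + 2) p, pow_mul, pow_mul, a3, a4] at e1
          simp only [mul_one, Int.cast_natCast] at hS
          rw [mul_comm (c + 2) p] at hS
          rw [hS] at e1
          push_cast
          linear_combination e1 + e3 + (β ^ c - α ^ c) * (α * β - 1) * a2)
        have h1 := Nat.fib_pos.2 (show 0 < c + 2 + 2 by omega)
        omega
  · by_contra! h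
    have h0 := S_zero _ h (luc_pos _)
    have hb1 : b = 1 := by
      by_contra hc
      obtain ⟨c, rfl⟩ : ∃ c, b = c + 2 := ⟨b - 2, by omega⟩
      simp [lucasNum] at h0
      have := luc_pos c
      have := luc_pos (c + 1)
      omega
    subst hb1
    obtain ⟨c, rfl⟩ : ∃ c, a = c + 1 := ⟨a - 1, by omega⟩
    have := key_zero _ h h0 (lucasNum (c + 1 + 1) + lucasNum c : ℤ) (by
      intro p _ α β a1 a2 a3 a4 a5 hS
      have e1 := aux_luc α β a1 a2 ((c + 1) * p + 1)
      have e3 := aux_luc α β a1 a2 c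
      rw [pow_succ, pow_succ, mul_comm (c + 1) p, pow_mul, pow_mul, a3, a4] at e1
      simp only [mul_one] at hS
      rw [mul_comm (c + 1) p] at hS
      rw [hS] at e1
      push_cast
      linear_combination e1 + e3 + (β ^ c + α ^ c) * a2)
    have h1 := luc_pos c
    have h2 := luc_pos (c + 1 + 1)
    omega
end

section
/- Let a be a positive integer and let b be a positive integer with b ≡ 1, 2, 8 or 19 (mod 20). Then S(n) = F_{5an+b} has the Lucas property with the prime 5. -/
theorem fib_aux_five (k b : ℕ) : ((Nat.fib (5 * k + b) : ℕ) : ZMod 5) = 3 ^ k * (Nat.fib b : ZMod 5) := by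
  induction k with
  | zero => simp
  | succ k ih =>
    have h : Nat.fib (5 * (k + 1) + b) = 5 * Nat.fib (5 * k + b + 1) + 3 * Nat.fib (5 * k + b) := by
      have e : 5 * (k + 1) + b = 5 * k + b + 5 := by ring
      rw [e]
      generalize 5 * k + b = m
      have h1 := Nat.fib_add_two (n := m)
      have h2 := Nat.fib_add_two (n := m + 1)
      have h3 := Nat.fib_add_two (n := m + 2)
      have h4 := Nat.fib_add_two (n := m + 3)
      simp only [Nat.add_assoc, Nat.reduceAdd] at *
      omega
    rw [h, pow_succ]
    push_cast
    rw [ih]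
    have h5 : (5 : ZMod 5) = 0 := by decide
    rw [h5]
    ring

theorem fib_lucasProperty_five (a b : ℕ) (ha : 0 < a) (hb : 0 < b)
    (hbmod : b % 20 = 1 ∨ b % 20 = 2 ∨ b % 20 = 8 ∨ b % 20 = 19) :
    HasLucasProperty 5 (fun n => (Nat.fib (5 * a * n + b) : ℤ)) := by
  have hFb : (Nat.fib b : ZMod 5) = 1 := by
    have e : b = 5 * (4 * (b / 20)) + b % 20 := by omega
    have h3 : (3 : ZMod 5) ^ 4 = 1 := by decide
    rw [e, fib_aux_five, pow_mul, h3, one_pow, one_mul]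
    rcases hbmod with h | h | h | h <;> rw [h] <;> norm_num [Nat.fib_add_two] <;> decide
  have hS : ∀ n, ((Nat.fib (5 * a * n + b) : ℕ) : ZMod 5) = (3 ^ a) ^ n := by
    intro n
    rw [mul_assoc, fib_aux_five, hFb, mul_one, pow_mul]
  intro r d _
  rw [← ZMod.intCast_eq_intCast_iff]
  push_cast
  simp only [hS]
  rw [← Finset.prod_pow_eq_pow_sum]
  refine Finset.prod_congr rfl fun i _ => ?_
  haveI : Fact (Nat.Prime 5) := ⟨by norm_num⟩
  rw [pow_mul, ZMod.pow_card_pow]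
end

section
/- Let a be a positive integer and let b be a positive integer with b ≡ 1 (mod 4). Then S(n) = L_{an+b} has the Lucas property with the prime 5. -/
theorem lucasNum_zmod (n : ℕ) : ((lucasNum n : ℤ) : ZMod 5) = 2 * 3 ^ n ∧
    ((lucasNum (n + 1) : ℤ) : ZMod 5) = 2 * 3 ^ (n + 1) := by
  induction n with
  | zero => constructor <;> simp [lucasNum] <;> decide
  | succ k ih =>
    refine ⟨ih.2, ?_⟩
    have h9 : (3 : ZMod 5) ^ 2 = 3 + 1 := by decide
    rw [lucasNum]
    push_cast
    rw [ih.1, ih.2]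
    linear_combination (-2 * 3 ^ k) * h9

theorem lucasNum_shift (a b n : ℕ) (h : b % 4 = 1) :
    ((lucasNum (a * n + b) : ℤ) : ZMod 5) = (3 ^ a) ^ n := by
  have hb : b = 4 * (b / 4) + 1 := by omega
  have h4 : (3 : ZMod 5) ^ 4 = 1 := by decide
  have h6 : (2 : ZMod 5) * 3 = 1 := by decide
  rw [(lucasNum_zmod _).1, hb, pow_add, pow_add, pow_mul, pow_mul, h4, one_pow]
  linear_combination ((3 ^ a) ^ n) * h6

theorem lucas_lucasProperty_five (a b : ℕ) (ha : 0 < a) (hb : 0 < b) (hbmod : b % 4 = 1) :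
    HasLucasProperty 5 (fun n => lucasNum (a * n + b)) := by
  intro r d _
  rw [← ZMod.intCast_eq_intCast_iff]
  push_cast
  rw [lucasNum_shift a b _ hbmod, ← Finset.prod_pow_eq_pow_sum]
  refine Finset.prod_congr rfl fun i _ => ?_
  rw [lucasNum_shift a b _ hbmod, mul_comm, pow_mul]
  haveI : Fact (Nat.Prime 5) := ⟨by norm_num⟩
  rw [ZMod.pow_card_pow]
end

section
/- Let p be a Fibonacci prime, i.e., there exists a positive integer a such that F_a = p. Then S(n) = F_{an+1} has the Lucas property with the prime p, and T(n) = L_{an+1} has the Lucas property with the prime p. -/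
theorem hasLucasProperty_of_pow (p : ℕ) (hp : p.Prime) (S : ℕ → ℤ) (c : ZMod p)
    (h : ∀ n, ((S n : ℤ) : ZMod p) = c ^ n) : HasLucasProperty p S := by
  haveI := Fact.mk hp
  intro r d _
  rw [← ZMod.intCast_eq_intCast_iff]
  push_cast
  simp only [h]
  rw [← Finset.prod_pow_eq_pow_sum]
  refine Finset.prod_congr rfl fun i _ => ?_
  rw [mul_comm, pow_mul, ZMod.pow_card_pow]

theorem lucasNum_succ_eq (n : ℕ) :
    lucasNum (n + 1) = 2 * (Nat.fib n : ℤ) + Nat.fib (n + 1) ∧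
    lucasNum (n + 2) = 2 * (Nat.fib (n + 1) : ℤ) + Nat.fib (n + 2) := by
  induction n with
  | zero => simp [lucasNum]
  | succ k ih =>
    refine ⟨ih.2, ?_⟩
    rw [lucasNum, ih.1, ih.2, Nat.fib_add_two (n := k + 1), Nat.fib_add_two (n := k)]
    push_cast
    ring

theorem fib_mul_zmod (p a : ℕ) (hfib : Nat.fib a = p) (n : ℕ) :
    ((Nat.fib (a * n) : ℕ) : ZMod p) = 0 := by
  rw [ZMod.natCast_eq_zero_iff]
  have := Nat.fib_dvd a (a * n) (Dvd.intro n rfl)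
  rwa [hfib] at this

theorem fib_mul_succ_zmod (p a : ℕ) (hfib : Nat.fib a = p) (n : ℕ) :
    ((Nat.fib (a * n + 1) : ℕ) : ZMod p) = (Nat.fib (a + 1) : ZMod p) ^ n := by
  induction n with
  | zero => simp
  | succ k ih =>
    rw [mul_add, mul_one, Nat.fib_add]
    push_cast
    rw [fib_mul_zmod p a hfib, ih, pow_succ]
    ring

theorem fibPrime_lucasProperty (p a : ℕ) (hp : p.Prime) (ha : 0 < a) (hfib : Nat.fib a = p) :
    HasLucasProperty p (fun n => (Nat.fib (a * n + 1) : ℤ)) ∧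
    HasLucasProperty p (fun n => lucasNum (a * n + 1)) := by
  refine ⟨hasLucasProperty_of_pow p hp _ (Nat.fib (a + 1) : ZMod p) fun n => ?_,
    hasLucasProperty_of_pow p hp _ (Nat.fib (a + 1) : ZMod p) fun n => ?_⟩
  · simpa using fib_mul_succ_zmod p a hfib n
  · have h1 := fib_mul_succ_zmod p a hfib n
    have h0 := fib_mul_zmod p a hfib n
    simp only [(lucasNum_succ_eq (a * n)).1]
    push_cast
    rw [h0, h1]
    ring
end

section
/- For every positive integer n, F_n ≡ n·3^{n−1} (mod 5). -/
theorem fib_mod_five_aux (k : ℕ) :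
    (5 : ℤ) ∣ ((k : ℤ) + 1) * 3 ^ k - (Nat.fib (k + 1) : ℤ) ∧
    (5 : ℤ) ∣ ((k : ℤ) + 2) * 3 ^ (k + 1) - (Nat.fib (k + 2) : ℤ) := by
  induction k with
  | zero => norm_num
  | succ k ih =>
    obtain ⟨⟨a, ha⟩, ⟨b, hb⟩⟩ := ih
    refine ⟨⟨b, ?_⟩, ⟨a + b + ((k : ℤ) + 4) * 3 ^ k, ?_⟩⟩
    · rw [← hb]
      push_cast
      ring
    · have h : Nat.fib (k + 1 + 2) = Nat.fib (k + 1) + Nat.fib (k + 2) := Nat.fib_add_two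
      rw [h]
      push_cast
      rw [pow_succ] at hb
      rw [pow_succ, pow_succ]
      linear_combination ha + hb

theorem fib_mod_five (n : ℕ) (hn : 0 < n) :
    (Nat.fib n : ℤ) ≡ (n : ℤ) * 3 ^ (n - 1) [ZMOD (5 : ℤ)] := by
  obtain ⟨k, rfl⟩ : ∃ k, n = k + 1 := ⟨n - 1, by omega⟩
  rw [Int.modEq_iff_dvd]
  simpa using (fib_mod_five_aux k).1
end

section
/- For all nonnegative integers n and r with r ≤ n, one has L_{n+r}·L_{n−r} − L_n² = (−1)^{n−r}·5·F_r², as an identity of integers. -/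
theorem lucasNum_step (n : ℕ) : lucasNum (n + 2) = lucasNum (n + 1) + lucasNum n := by
  rw [lucasNum]

theorem lucasNum_add (m r : ℕ) :
    lucasNum (m + r) = ((Nat.fib (r + 1) : ℤ) - Nat.fib r) * lucasNum m
        + Nat.fib r * lucasNum (m + 1) ∧
    lucasNum (m + r + 1) = (Nat.fib r : ℤ) * lucasNum m
        + Nat.fib (r + 1) * lucasNum (m + 1) := by
  induction r with
  | zero => simp
  | succ k ih =>
    obtain ⟨h1, h2⟩ := ih
    have hf : (Nat.fib (k + 1 + 1) : ℤ) = Nat.fib k + Nat.fib (k + 1) := by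
      rw [Nat.fib_add_two]; push_cast; ring
    have hs : lucasNum (m + (k + 1) + 1) = lucasNum (m + k + 1) + lucasNum (m + k) :=
      lucasNum_step (m + k)
    constructor
    · rw [← add_assoc, h2, hf]; ring
    · rw [hs, h1, h2, hf]; ring

theorem lucasNum_cassini (m : ℕ) :
    lucasNum m ^ 2 + lucasNum m * lucasNum (m + 1) - lucasNum (m + 1) ^ 2 = (-1) ^ m * 5 := by
  induction m with
  | zero => norm_num [lucasNum]
  | succ k ih =>
    rw [show k + 1 + 1 = k + 2 from rfl, lucasNum_step, pow_succ]
    linear_combination -ih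

theorem lucas_catalan_identity (n r : ℕ) (h : r ≤ n) :
    lucasNum (n + r) * lucasNum (n - r) - lucasNum n ^ 2 =
      (-1) ^ (n - r) * 5 * (Nat.fib r : ℤ) ^ 2 := by
  obtain ⟨m, rfl⟩ := Nat.exists_eq_add_of_le' h
  rw [Nat.add_sub_cancel, (lucasNum_add (m + r) r).1, (lucasNum_add m r).1,
    (lucasNum_add m r).2, ← lucasNum_cassini]
  ring
end

section
/- Let u, v, A_0, A_1 be integers and let (A_n) satisfy A_n = u·A_{n−1} + v·A_{n−2} for n ≥ 2. Then for all integers n and r with 1 ≤ r ≤ n, one has A_{n+r}·A_{n−r} − A_n² = (−v)^{n−r}·s(r−1,u,v)²·(v·A_0² + u·A_0·A_1 − A_1²). -/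
/-- `s(k,u,v) = ∑_{i=0}^{⌊k/2⌋} C(k-i, i) u^(k-2i) v^i`. -/
def sPoly (k : ℕ) (u v : ℤ) : ℤ :=
  ∑ i ∈ Finset.range (k / 2 + 1), (Nat.choose (k - i) i : ℤ) * u ^ (k - 2 * i) * v ^ i

theorem sPoly_ext (k N : ℕ) (u v : ℤ) (h : k / 2 + 1 ≤ N) :
    sPoly k u v = ∑ i ∈ Finset.range N,
      (Nat.choose (k - i) i : ℤ) * u ^ (k - 2 * i) * v ^ i := by
  unfold sPoly
  apply Finset.sum_subset
  · intro i hi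
    simp only [Finset.mem_range] at *
    omega
  · intro i _ hi
    simp only [Finset.mem_range] at hi
    rw [Nat.choose_eq_zero_of_lt (by omega)]
    simp

theorem sPoly_rec (k : ℕ) (u v : ℤ) :
    sPoly (k + 2) u v = u * sPoly (k + 1) u v + v * sPoly k u v := by
  rw [sPoly_ext (k + 2) (k + 1 + 1) u v (by omega), sPoly_ext (k + 1) (k + 1 + 1) u v (by omega),
    sPoly_ext k (k + 1) u v (by omega), Finset.sum_range_succ', Finset.sum_range_succ' _ (k + 1),
    mul_add, Finset.mul_sum, Finset.mul_sum, add_right_comm, ← Finset.sum_add_distrib]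
  congr 1
  · apply Finset.sum_congr rfl
    intro i hi
    have hi' : i ≤ k := by simpa [Nat.lt_succ_iff] using hi
    have e1 : k + 2 - (i + 1) = (k - i) + 1 := by omega
    have e2 : k + 1 - (i + 1) = k - i := by omega
    have e3 : k + 2 - 2 * (i + 1) = k - 2 * i := by omega
    rw [e1, e2, e3, Nat.choose_succ_succ]
    by_cases hc : k - i < i + 1
    · rw [Nat.choose_eq_zero_of_lt hc]
      push_cast
      ring
    · have e4 : k - 2 * i = (k + 1 - 2 * (i + 1)) + 1 := by omega
      rw [e4]
      push_cast
      ring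
  · simp
    ring

theorem linRec_shift (u v : ℤ) (A : ℕ → ℤ)
    (hA : ∀ n : ℕ, A (n + 2) = u * A (n + 1) + v * A n) (k : ℕ) : ∀ m : ℕ,
    A (m + (k + 2)) = sPoly (k + 1) u v * A (m + 1) + v * sPoly k u v * A m := by
  have h0 : sPoly 0 u v = 1 := by simp [sPoly]
  have h1 : sPoly 1 u v = u := by simp [sPoly]
  induction k with
  | zero => intro m; rw [h0, h1]; simp [hA]
  | succ k ih =>
    intro m
    have := ih (m + 1)
    rw [show m + (k + 1 + 2) = m + 1 + (k + 2) by ring, this, sPoly_rec,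
      show m + 1 + 1 = m + 2 by ring, hA]
    ring

theorem linRec_catalan_identity (u v : ℤ) (A : ℕ → ℤ)
    (hA : ∀ n : ℕ, A (n + 2) = u * A (n + 1) + v * A n)
    (n r : ℕ) (hr : 1 ≤ r) (hrn : r ≤ n) :
    A (n + r) * A (n - r) - A n ^ 2 =
      (-v) ^ (n - r) * sPoly (r - 1) u v ^ 2 * (v * A 0 ^ 2 + u * A 0 * A 1 - A 1 ^ 2) := by
  obtain ⟨m, rfl⟩ := Nat.exists_eq_add_of_le' hrn
  rw [Nat.add_sub_cancel]
  have key : ∀ m : ℕ, v * A m ^ 2 + u * A m * A (m + 1) - A (m + 1) ^ 2 =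
      (-v) ^ m * (v * A 0 ^ 2 + u * A 0 * A 1 - A 1 ^ 2) := by
    intro m
    induction m with
    | zero => simp
    | succ m ih =>
      rw [show m + 1 + 1 = m + 2 by ring, hA]
      linear_combination (-v) * ih
  rw [mul_right_comm, ← key]
  obtain ⟨k, rfl⟩ := Nat.exists_eq_add_of_le' hr
  rw [Nat.add_sub_cancel]
  rcases k with _ | k
  · have h0 : sPoly 0 u v = 1 := by simp [sPoly]
    rw [h0, show m + (0 + 1) + (0 + 1) = m + 2 by ring, hA]
    simp
    ring
  · have a := linRec_shift u v A hA k
    rw [show m + (k + 1 + 1) + (k + 1 + 1) = (m + (k + 2)) + (k + 2) by ring, a (m + (k + 2)),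
      show m + (k + 2) + 1 = m + (k + 1 + 2) by ring, linRec_shift u v A hA (k + 1) m,
      show m + (k + 1 + 1) = m + (k + 2) by ring, a m, sPoly_rec]
    ring
end

section
/- Let u, v, A_0, A_1 be integers and let (A_n) satisfy A_n = u·A_{n−1} + v·A_{n−2} for n ≥ 2. Then for all integers n and r with 1 ≤ r < n, one has A_{n+r}·A_{n−r} − A_n² = (−1)^{n−r}·v^{n−r−1}·t(r,u,v)·(A_{r+1}·A_0 − A_r·A_1). -/
/-- `t(k,u,v) = ∑_{j=0}^{⌊(k-1)/2⌋} C(k-1-j, j) u^(k-1-2j) v^(j+1)`, for `k ≥ 1`. -/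
def tPoly (k : ℕ) (u v : ℤ) : ℤ :=
  ∑ j ∈ Finset.range ((k - 1) / 2 + 1),
    (Nat.choose (k - 1 - j) j : ℤ) * u ^ (k - 1 - 2 * j) * v ^ (j + 1)

def auxF (u v : ℤ) : ℕ → ℤ
  | 0 => 0
  | 1 => 1
  | (n + 2) => u * auxF u v (n + 1) + v * auxF u v n

def auxG (u v : ℤ) (s : ℕ) : ℤ :=
  ∑ p ∈ Finset.HasAntidiagonal.antidiagonal s, (Nat.choose p.1 p.2 : ℤ) * u ^ (p.1 - p.2) * v ^ p.2

lemma auxG_rec (u v : ℤ) (s : ℕ) :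
    auxG u v (s + 2) = u * auxG u v (s + 1) + v * auxG u v s := by
  unfold auxG
  rw [Finset.Nat.antidiagonal_succ_succ', Finset.Nat.antidiagonal_succ']
  simp only [Finset.sum_cons, Finset.sum_map, Function.Embedding.prodMap, Prod.map,
    Function.Embedding.coeFn_mk, Function.Embedding.refl_apply]
  have h : ∀ p ∈ Finset.HasAntidiagonal.antidiagonal s,
      (Nat.choose (p.1 + 1) (p.2 + 1) : ℤ) * u ^ (p.1 + 1 - (p.2 + 1)) * v ^ (p.2 + 1)
      = u * ((Nat.choose p.1 (p.2 + 1) : ℤ) * u ^ (p.1 - (p.2 + 1)) * v ^ (p.2 + 1))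
        + v * ((Nat.choose p.1 p.2 : ℤ) * u ^ (p.1 - p.2) * v ^ p.2) := by
    rintro ⟨i, j⟩ -
    simp only [Nat.add_sub_add_right, Nat.choose_succ_succ]
    by_cases hij : j + 1 ≤ i
    · obtain ⟨d, rfl⟩ := Nat.exists_eq_add_of_le hij
      have h1 : j + 1 + d - j = d + 1 := by omega
      have h2 : j + 1 + d - (j + 1) = d := by omega
      rw [h1, h2]; push_cast; ring
    · have : i.choose (j + 1) = 0 := Nat.choose_eq_zero_of_lt (by omega)
      simp only [Nat.succ_eq_add_one, this]; push_cast; ring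
  have h' := Finset.sum_congr rfl h
  rw [Finset.sum_add_distrib, ← Finset.mul_sum, ← Finset.mul_sum] at h'
  simp only [Nat.succ_eq_add_one] at *
  rw [h']
  simp
  ring

lemma auxG_eq (u v : ℤ) : ∀ s, auxG u v s = auxF u v (s + 1)
  | 0 => by simp [auxG, auxF]
  | 1 => by simp [auxG, auxF, Finset.Nat.antidiagonal_succ]
  | (s + 2) => by
    rw [auxG_rec, auxG_eq u v s, auxG_eq u v (s + 1)]; rfl

lemma tPoly_eq (u v : ℤ) (s : ℕ) : tPoly (s + 1) u v = v * auxF u v (s + 1) := by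
  rw [← auxG_eq, auxG, ← Finset.Nat.sum_antidiagonal_swap,
    Finset.Nat.sum_antidiagonal_eq_sum_range_succ_mk, tPoly, Finset.mul_sum]
  simp only [Nat.add_sub_cancel, Prod.swap, Nat.succ_eq_add_one]
  have hs : Finset.range (s / 2 + 1) ⊆ Finset.range (s + 1) := by
    intro x; simp only [Finset.mem_range]; omega
  rw [← Finset.sum_subset hs]
  · refine Finset.sum_congr rfl fun j _ => ?_
    have : s - j - j = s - 2 * j := by omega
    rw [this]; ring
  · intro x _ hx
    simp only [Finset.mem_range] at *
    rw [Nat.choose_eq_zero_of_lt (by omega)]; simp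

lemma aux_add (u v : ℤ) (A : ℕ → ℤ)
    (hA : ∀ n : ℕ, A (n + 2) = u * A (n + 1) + v * A n) (m : ℕ) :
    ∀ k, A (m + (k + 1)) = auxF u v (k + 1) * A (m + 1) + v * auxF u v k * A m
  | 0 => by simp [auxF]
  | 1 => by simp [auxF, hA]
  | (k + 2) => by
    have h1 := aux_add u v A hA m k
    have h2 := aux_add u v A hA m (k + 1)
    have h3 := hA (m + (k + 1))
    have e1 : auxF u v (k + 2 + 1) = u * auxF u v (k + 2) + v * auxF u v (k + 1) := rfl
    have e2 : auxF u v (k + 2) = u * auxF u v (k + 1) + v * auxF u v k := rfl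
    have e3 : A (m + (k + 2 + 1)) = u * A (m + (k + 1 + 1)) + v * A (m + (k + 1)) := h3
    rw [e3, h1, h2, e1]
    simp only [Nat.add_assoc, Nat.reduceAdd, e2]; ring

lemma aux_C (u v : ℤ) (A : ℕ → ℤ)
    (hA : ∀ n : ℕ, A (n + 2) = u * A (n + 1) + v * A n) (r m : ℕ) :
    A (m + r + 1) * A m - A (m + r) * A (m + 1)
      = (-v) ^ m * (A (r + 1) * A 0 - A r * A 1) := by
  induction m with
  | zero => simp
  | succ m ih =>
    have h1 : A (m + 1 + r + 1) = u * A (m + r + 1) + v * A (m + r) := by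
      rw [← hA]; congr 1; omega
    have h2 : A (m + 1 + r) = A (m + r + 1) := by congr 1; omega
    rw [pow_succ, h1, h2, hA m]
    linear_combination (-v) * ih

theorem linRec_catalan_t_identity (u v : ℤ) (A : ℕ → ℤ)
    (hA : ∀ n : ℕ, A (n + 2) = u * A (n + 1) + v * A n)
    (n r : ℕ) (hr : 1 ≤ r) (hrn : r < n) :
    A (n + r) * A (n - r) - A n ^ 2 =
      (-1) ^ (n - r) * v ^ (n - r - 1) * tPoly r u v * (A (r + 1) * A 0 - A r * A 1) := by
  obtain ⟨k, rfl⟩ := Nat.exists_eq_add_of_le' hr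
  obtain ⟨m, rfl⟩ : ∃ m, n = m + 1 + (k + 1) := ⟨n - (k + 1) - 1, by omega⟩
  have e : m + 1 + (k + 1) - (k + 1) = m + 1 := by omega
  rw [e, tPoly_eq, Nat.add_sub_cancel]
  have h1 := aux_add u v A hA (m + 1) k
  have h2 := aux_add u v A hA (m + 1 + (k + 1)) k
  have h3 := aux_C u v A hA (k + 1) (m + 1)
  have h4 : (-v) ^ (m + 1) = (-1) ^ (m + 1) * v ^ m * v := by
    rw [neg_pow, pow_succ v]; ring
  rw [h4] at h3
  linear_combination A (m + 1) * h2 - A (m + 1 + (k + 1)) * h1 + auxF u v (k + 1) * h3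
end
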